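/- Let 1 ≤ k ≤ n and let W be an n×n real symmetric positive definite matrix. Then for every symmetric n×n real matrix ξ: (d²/dt²)|_{t=0} σ_k(W + tξ) + (d/ds)|_{s=0} σ_k(W + s·ξW^{−1}ξ) ≥ (d/dt)|_{t=0} σ_k(W + tξ)² / σ_k(W). (Here ξW^{−1}ξ is again a symmetric matrix, and the left-hand side equals (σ_k^{αβ,γη}(W) + w^{αη}σ_k^{βγ}(W))ξ_{αβ}ξ_{γη} where (w^{αβ}) = W^{−1}.) -/

import Mathlib

open scoped Classical

noncomputable section

/-- The `j`-th elementary symmetric function of the family `κ` restricted to the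
finite index set `s`; it is `1` for `j = 0`, and `0` for `j < 0` (or for `j`
larger than the cardinality of `s`). -/
def sigmaE {ι : Type*} (s : Finset ι) (j : ℤ) (κ : ι → ℝ) : ℝ :=
  if 0 ≤ j then ∑ t ∈ s.powersetCard j.toNat, ∏ i ∈ t, κ i else 0

/-- `σ_j(κ)`, the `j`-th elementary symmetric polynomial evaluated at `κ`. -/
def sigmaV {ι : Type*} [Fintype ι] (j : ℤ) (κ : ι → ℝ) : ℝ :=
  sigmaE Finset.univ j κ

/-- `σ_j(κ|α)`: `σ_j` of `κ` with the `α`-th entry deleted. -/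
def sigmaV1 {ι : Type*} [Fintype ι] [DecidableEq ι] (j : ℤ) (κ : ι → ℝ) (α : ι) : ℝ :=
  sigmaE (Finset.univ.erase α) j κ

/-- `σ_j(κ|αβ)`: `σ_j` of `κ` with the `α`-th and `β`-th entries deleted. -/
def sigmaV2 {ι : Type*} [Fintype ι] [DecidableEq ι] (j : ℤ) (κ : ι → ℝ) (α β : ι) : ℝ :=
  sigmaE ((Finset.univ.erase α).erase β) j κ

/-- `σ_j(A)` for a real `n × n` matrix `A`: the `j`-th elementary symmetric function of
the eigenvalues of `A` when `A` is symmetric (= Hermitian over `ℝ`), junk value `0`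
otherwise. -/
def sigmaMat {n : ℕ} (j : ℤ) (A : Matrix (Fin n) (Fin n) ℝ) : ℝ :=
  if h : A.IsHermitian then sigmaV j h.eigenvalues else 0

/-- The Hessian quotient operator `F(A) = σ_n(A)/σ_{n-k}(A)`. -/
def Fquot {n : ℕ} (k : ℕ) (A : Matrix (Fin n) (Fin n) ℝ) : ℝ :=
  sigmaMat (n : ℤ) A / sigmaMat ((n : ℤ) - (k : ℤ)) A

section

open Matrix Polynomial
open scoped MatrixOrder

/-- Simultaneous reduction: the pencil `A + t B` with `A` positive definite has determinant
`det A * ∏ (1 + t xᵢ)`, where the `xᵢ` are the eigenvalues of `A⁻¹ B`. -/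
lemma exists_det_add_smul_eq_prod {m : Type*} [Fintype m] [DecidableEq m]
    {A B : Matrix m m ℝ} (hA : A.PosDef) (hB : B.IsHermitian) :
    ∃ x : m → ℝ, (∀ t : ℝ, (A + t • B).det = A.det * ∏ i, (1 + t * x i)) ∧
      ∑ i, x i = (A⁻¹ * B).trace ∧ ∑ i, x i ^ 2 = (A⁻¹ * B * (A⁻¹ * B)).trace := by
  obtain ⟨y, hy⟩ := CStarAlgebra.nonneg_iff_eq_star_mul_self.mp hA.inv.posSemidef.nonneg
  rw [star_eq_conjTranspose] at hy
  have hdet : IsUnit A.det := (isUnit_iff_isUnit_det A).mp hA.isUnit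
  have hyA : y * A * yᴴ = 1 := by
    rw [mul_eq_one_comm, ← Matrix.mul_assoc, ← hy, nonsing_inv_mul _ hdet]
  have hX : (y * B * yᴴ).IsHermitian := isHermitian_mul_mul_conjTranspose y hB
  have hyy : A.det * (y.det * yᴴ.det) = 1 := by
    have := congrArg det hyA
    rw [det_mul, det_mul, det_one] at this
    linarith
  set U := hX.eigenvectorUnitary
  have hspec := hX.spectral_theorem
  rw [Unitary.conjStarAlgAut_apply] at hspec
  have hd : (RCLike.ofReal ∘ hX.eigenvalues : m → ℝ) = hX.eigenvalues := rfl
  rw [hd] at hspec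
  have hU : (U : Matrix m m ℝ) * star (U : Matrix m m ℝ) = 1 := Unitary.coe_mul_star_self U
  have hU' : star (U : Matrix m m ℝ) * (U : Matrix m m ℝ) = 1 := Unitary.coe_star_mul_self U
  refine ⟨hX.eigenvalues, fun t => ?_, ?_, ?_⟩
  · have h1 : y * (A + t • B) * yᴴ =
        U * (1 + t • diagonal hX.eigenvalues) * star (U : Matrix m m ℝ) := by
      rw [Matrix.mul_add, Matrix.add_mul, hyA, Matrix.mul_smul, Matrix.smul_mul, Matrix.mul_add,
        Matrix.add_mul, Matrix.mul_one, hU, Matrix.mul_smul, Matrix.smul_mul, ← hspec]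
    have h2 : (1 + t • diagonal hX.eigenvalues : Matrix m m ℝ) =
        diagonal fun i => 1 + t * hX.eigenvalues i := by
      ext i j
      by_cases h : i = j <;> simp [h]
    have h3 := congrArg det h1
    rw [h2, det_mul, det_mul, det_mul_right_comm, hU, Matrix.one_mul, det_diagonal] at h3
    rw [← h3]
    linear_combination -(A + t • B).det * hyy
  · have := hX.trace_eq_sum_eigenvalues
    simp only [RCLike.ofReal_real_eq_id, id] at this
    rw [← this, hy, trace_mul_comm, ← Matrix.mul_assoc]
  · calc ∑ i, hX.eigenvalues i ^ 2
        = (U * diagonal hX.eigenvalues * star (U : Matrix m m ℝ) *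
          (U * diagonal hX.eigenvalues * star (U : Matrix m m ℝ))).trace := by
          rw [show (U * diagonal hX.eigenvalues * star (U : Matrix m m ℝ) *
            (U * diagonal hX.eigenvalues * star (U : Matrix m m ℝ))) =
            U * (diagonal hX.eigenvalues * (star (U : Matrix m m ℝ) * U) *
              diagonal hX.eigenvalues) * star (U : Matrix m m ℝ) by
              simp only [Matrix.mul_assoc], hU', trace_mul_cycle, hU']
          simp [trace, sq]
      _ = (y * B * yᴴ * (y * B * yᴴ)).trace := by rw [← hspec]
      _ = _ := by
          rw [hy, ← trace_mul_cycle]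
          simp only [Matrix.mul_assoc]

lemma eval_zero_derivatives_prod_one_add {m : Type*} (s : Finset m) (x : m → ℝ) :
    (∏ i ∈ s, (1 + C (x i) * X)).eval 0 = 1 ∧
    (derivative (∏ i ∈ s, (1 + C (x i) * X))).eval 0 = ∑ i ∈ s, x i ∧
    (derivative (derivative (∏ i ∈ s, (1 + C (x i) * X)))).eval 0 =
      (∑ i ∈ s, x i) ^ 2 - ∑ i ∈ s, x i ^ 2 := by
  induction s using Finset.induction_on with
  | empty => simp
  | insert a s ha ih =>
    obtain ⟨h0, h1, h2⟩ := ih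
    rw [Finset.prod_insert ha, Finset.sum_insert ha, Finset.sum_insert ha]
    refine ⟨by simp [h0], by simp [h0, h1], ?_⟩
    simp [h1, h2]
    ring

/-- The determinant of the pencil `A + t B` is polynomial in `t`, with the expected
first and second derivatives at `0`. -/
lemma exists_polynomial_det_add_smul {m : Type*} [Fintype m] [DecidableEq m]
    {A B : Matrix m m ℝ} (hA : A.PosDef) (hB : B.IsHermitian) :
    ∃ p : ℝ[X], (∀ t : ℝ, (A + t • B).det = p.eval t) ∧
      (derivative p).eval 0 = A.det * (A⁻¹ * B).trace ∧
      (derivative (derivative p)).eval 0 =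
        A.det * ((A⁻¹ * B).trace ^ 2 - (A⁻¹ * B * (A⁻¹ * B)).trace) := by
  obtain ⟨x, hdet, hsum, hsq⟩ := exists_det_add_smul_eq_prod hA hB
  obtain ⟨-, h1, h2⟩ := eval_zero_derivatives_prod_one_add Finset.univ x
  refine ⟨C A.det * ∏ i, (1 + C (x i) * X), fun t => ?_, ?_, ?_⟩
  · simp [hdet, eval_prod, mul_comm t]
  · simp [h1, hsum]
  · simp [h2, hsum, hsq]

lemma trace_mul_nonneg_of_posSemidef {m : Type*} [Fintype m] [DecidableEq m]
    {P D : Matrix m m ℝ} (hP : P.PosSemidef) (hD : D.PosSemidef) : 0 ≤ (P * D).trace := by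
  obtain ⟨y, rfl⟩ := CStarAlgebra.nonneg_iff_eq_star_mul_self.mp hP.nonneg
  rw [star_eq_conjTranspose, Matrix.mul_assoc, trace_mul_comm]
  exact (hD.mul_mul_conjTranspose_same y).trace_nonneg

/-- The inverse of a compression is dominated by the compression of the inverse. -/
lemma posSemidef_inv_sub_compression {m l : Type*} [Fintype m] [DecidableEq m] [Fintype l]
    [DecidableEq l] {W : Matrix m m ℝ} (hW : W.PosDef) (E : Matrix m l ℝ)
    (hA : (Eᴴ * W * E).PosDef) : (W⁻¹ - E * (Eᴴ * W * E)⁻¹ * Eᴴ).PosSemidef := by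
  set A := Eᴴ * W * E with hAdef
  have hWdet : IsUnit W.det := (isUnit_iff_isUnit_det W).mp hW.isUnit
  have hAdet : IsUnit A.det := (isUnit_iff_isUnit_det A).mp hA.isUnit
  set P := W⁻¹ - E * A⁻¹ * Eᴴ with hPdef
  have hPH : Pᴴ = P :=
    (hW.inv.isHermitian.sub (isHermitian_mul_mul_conjTranspose E hA.inv.isHermitian)).eq
  have hEWE : E * A⁻¹ * Eᴴ * W * (E * A⁻¹ * Eᴴ) = E * A⁻¹ * Eᴴ := by
    rw [show E * A⁻¹ * Eᴴ * W * (E * A⁻¹ * Eᴴ) = E * A⁻¹ * (Eᴴ * W * E) * A⁻¹ * Eᴴ by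
      simp only [Matrix.mul_assoc], ← hAdef, Matrix.mul_assoc E, nonsing_inv_mul _ hAdet,
      Matrix.mul_one]
  have hPWP : Pᴴ * W * P = P := by
    rw [hPH]
    conv_lhs => rw [hPdef, Matrix.sub_mul, nonsing_inv_mul _ hWdet, Matrix.sub_mul, Matrix.one_mul,
      Matrix.mul_sub, hEWE, Matrix.mul_assoc _ W, mul_nonsing_inv _ hWdet, Matrix.mul_one, sub_self,
      sub_zero]
  rw [← hPWP]
  exact hW.posSemidef.conjTranspose_mul_mul_same P

/-- The trace of `A⁻¹ B A⁻¹ B` for principal submatrices `A` of `W` and `B` of `ξ` is at most that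
of `A⁻¹` times the corresponding principal submatrix of `ξ W⁻¹ ξ`. -/
lemma trace_inv_submatrix_le {m l : Type*} [Fintype m] [DecidableEq m] [Fintype l]
    [DecidableEq l] {W ξ : Matrix m m ℝ} (hW : W.PosDef) (hξ : ξ.IsHermitian)
    {e : l → m} (he : Function.Injective e) :
    ((W.submatrix e e)⁻¹ * ξ.submatrix e e * ((W.submatrix e e)⁻¹ * ξ.submatrix e e)).trace ≤
      ((W.submatrix e e)⁻¹ * (ξ * W⁻¹ * ξ).submatrix e e).trace := by
  set E : Matrix m l ℝ := (1 : Matrix m m ℝ).submatrix id e with hE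
  have hsub : ∀ M : Matrix m m ℝ, M.submatrix e e = Eᴴ * M * E := by
    intro M
    ext i j
    simp [hE, Matrix.mul_apply, Matrix.one_apply]
  have hA : (W.submatrix e e).PosDef := hW.submatrix he
  have hP := posSemidef_inv_sub_compression hW E (hsub W ▸ hA)
  rw [← hsub W] at hP
  have hD := hP.conjTranspose_mul_mul_same (ξ * E)
  have key := trace_mul_nonneg_of_posSemidef hA.inv.posSemidef hD
  rw [conjTranspose_mul, hξ.eq, Matrix.mul_sub, Matrix.sub_mul, Matrix.mul_sub, trace_sub] at key
  rw [hsub ξ, hsub (ξ * W⁻¹ * ξ)]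
  simp only [Matrix.mul_assoc] at key ⊢
  linarith

/-- `σ_k` of a symmetric matrix is the sum of its principal `k × k` minors. -/
lemma sigmaMat_eq_sum_minors {n k : ℕ} (hk : k ≤ n) {A : Matrix (Fin n) (Fin n) ℝ}
    (hA : A.IsHermitian) :
    sigmaMat (k : ℤ) A = ∑ s ∈ (Finset.univ : Finset (Fin n)).powersetCard k,
      (A.submatrix (Subtype.val : s → Fin n) (Subtype.val : s → Fin n)).det := by
  have h1 := charpoly_coeff_eq_sum_minors A k (by simpa using hk)
  have h2 := Multiset.prod_X_sub_C_coeff (Finset.univ.val.map hA.eigenvalues)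
    (k := n - k) (by simp)
  have h3 : (Multiset.map (fun t => X - C t) (Finset.univ.val.map hA.eigenvalues)).prod =
      A.charpoly := by
    rw [hA.charpoly_eq]
    rw [Multiset.map_map]
    rfl
  rw [h3] at h2
  simp only [Multiset.card_map, Finset.card_val, Finset.card_univ, Fintype.card_fin,
    Nat.sub_sub_self hk, Finset.esymm_map_val] at h1 h2
  rw [h1] at h2
  have h4 := mul_left_cancel₀ (pow_ne_zero k (by norm_num : (-1 : ℝ) ≠ 0)) h2
  simp only [sigmaMat, dif_pos hA, sigmaV, sigmaE, Int.natCast_nonneg, if_true, Int.toNat_natCast]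
  rw [← h4]

/-- Along a line through a positive definite matrix, `σ_k` is a sum of polynomials, one for each
principal minor, with explicit first and second derivatives at `0`. -/
lemma exists_polynomial_sigmaMat_add_smul {n k : ℕ} (hk : k ≤ n) {W B : Matrix (Fin n) (Fin n) ℝ}
    (hW : W.PosDef) (hB : B.IsHermitian) :
    ∃ p : Finset (Fin n) → ℝ[X],
      (fun t : ℝ => sigmaMat (k : ℤ) (W + t • B)) = (fun t => eval t
        (∑ s ∈ (Finset.univ : Finset (Fin n)).powersetCard k, p s)) ∧
      ∀ s : Finset (Fin n),
        let A := W.submatrix (Subtype.val : s → Fin n) (Subtype.val : s → Fin n)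
        let D := B.submatrix (Subtype.val : s → Fin n) (Subtype.val : s → Fin n)
        (derivative (p s)).eval 0 = A.det * (A⁻¹ * D).trace ∧
        (derivative (derivative (p s))).eval 0 =
          A.det * ((A⁻¹ * D).trace ^ 2 - (A⁻¹ * D * (A⁻¹ * D)).trace) := by
  choose p hp using fun s : Finset (Fin n) => exists_polynomial_det_add_smul
    (hW.submatrix (Subtype.val_injective (p := (· ∈ s))))
    (hB.submatrix (Subtype.val : s → Fin n))
  refine ⟨p, ?_, fun s => (hp s).2⟩
  funext t
  rw [sigmaMat_eq_sum_minors hk (hW.isHermitian.add (hB.smul (IsSelfAdjoint.all t))),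
    eval_finsetSum]
  exact Finset.sum_congr rfl fun s _ => (hp s).1 t

lemma iteratedDeriv_two_polynomial_eval (p : ℝ[X]) (x : ℝ) :
    iteratedDeriv 2 (fun t => p.eval t) x = (derivative (derivative p)).eval x := by
  rw [iteratedDeriv_succ, iteratedDeriv_one]
  have : deriv (fun t => p.eval t) = fun t => (derivative p).eval t := funext fun t => p.deriv
  rw [this, Polynomial.deriv]

end

/-- Lemma of Guan–Li–Zhang: for `1 ≤ k ≤ n` and `W` symmetric positive
definite, for every symmetric `ξ`:
`(d²/dt²)|₀ σ_k(W+tξ) + (d/ds)|₀ σ_k(W + s ξW⁻¹ξ) ≥ ((d/dt)|₀ σ_k(W+tξ))² / σ_k(W)`. -/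
theorem stmt_1 (n k : ℕ) (hk1 : 1 ≤ k) (hk2 : k ≤ n)
    (W : Matrix (Fin n) (Fin n) ℝ) (hW : W.PosDef)
    (ξ : Matrix (Fin n) (Fin n) ℝ) (hξ : ξ.IsSymm) :
    iteratedDeriv 2 (fun t : ℝ => sigmaMat (k : ℤ) (W + t • ξ)) 0
      + deriv (fun s : ℝ => sigmaMat (k : ℤ) (W + s • (ξ * W⁻¹ * ξ))) 0
    ≥ (deriv (fun t : ℝ => sigmaMat (k : ℤ) (W + t • ξ)) 0) ^ 2 / sigmaMat (k : ℤ) W := by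
  have hξH : ξ.IsHermitian := by
    rw [Matrix.IsHermitian, Matrix.conjTranspose_eq_transpose_of_trivial, hξ]
  have hηH : (ξ * W⁻¹ * ξ).IsHermitian := by
    have h := Matrix.isHermitian_mul_mul_conjTranspose ξ hW.inv.isHermitian
    rwa [hξH.eq] at h
  obtain ⟨p, hp, hp'⟩ := exists_polynomial_sigmaMat_add_smul hk2 hW hξH
  obtain ⟨q, hq, hq'⟩ := exists_polynomial_sigmaMat_add_smul hk2 hW hηH
  rw [hp, hq, iteratedDeriv_two_polynomial_eval, Polynomial.deriv, Polynomial.deriv,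
    sigmaMat_eq_sum_minors hk2 hW.isHermitian]
  simp only [Polynomial.derivative_sum, Polynomial.eval_finsetSum,
    fun s => (hp' s).1, fun s => (hp' s).2, fun s => (hq' s).1]
  have hpos : ∀ s : Finset (Fin n),
      0 < (W.submatrix (Subtype.val : s → Fin n) (Subtype.val : s → Fin n)).det :=
    fun s => (hW.submatrix Subtype.val_injective).det_pos
  refine (Finset.sq_sum_div_le_sum_sq_div _ _ fun s _ => hpos s).trans ?_
  rw [← Finset.sum_add_distrib]
  refine Finset.sum_le_sum fun s _ => ?_
  have htr := mul_le_mul_of_nonneg_left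
    (trace_inv_submatrix_le hW hξH (Subtype.val_injective (p := (· ∈ s)))) (hpos s).le
  rw [div_le_iff₀ (hpos s)]
  nlinarith [mul_le_mul_of_nonneg_left htr (hpos s).le]
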